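/- arXiv:1009.2990 — 6 statements merged into one kernel-verified Lean document; each statement's English description precedes it below -/
import Mathlib

section
/- For every N ≥ 0, the total mass of μ_N equals 2^N, i.e. Σ_{(a,b)∈ℤ²} μ_N(a,b) = 2^N. (Equivalently, dim V_{w_N}(Λ₀) = 2^N.) -/
/-- The image of the delta measure at `p` under the Demazure operator `D₀`, acting in the
coordinates `λ = Λ₀ - a·α₀ - b·α₁`: `D₀ δ_{(a,b)} = ∑_{i=0}^{1-2a+2b} δ_{(a+i,b)}`, with the
signed-sum convention `∑_{i=0}^{-1} = 0` and `∑_{i=0}^{n} = -∑_{i=n+1}^{-1}` for `n ≤ -2`. -/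
noncomputable def elemD0 (p : ℤ × ℤ) : (ℤ × ℤ) →₀ ℤ :=
  (∑ i ∈ Finset.Icc (0 : ℤ) (1 - 2 * p.1 + 2 * p.2), Finsupp.single (p.1 + i, p.2) (1 : ℤ))
  - (∑ i ∈ Finset.Icc (1 - 2 * p.1 + 2 * p.2 + 1) (-1 : ℤ), Finsupp.single (p.1 + i, p.2) (1 : ℤ))

/-- The image of the delta measure at `p` under the Demazure operator `D₁`:
`D₁ δ_{(a,b)} = ∑_{i=0}^{2a-2b} δ_{(a,b+i)}`, with the signed-sum convention. -/
noncomputable def elemD1 (p : ℤ × ℤ) : (ℤ × ℤ) →₀ ℤ :=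
  (∑ i ∈ Finset.Icc (0 : ℤ) (2 * p.1 - 2 * p.2), Finsupp.single (p.1, p.2 + i) (1 : ℤ))
  - (∑ i ∈ Finset.Icc (2 * p.1 - 2 * p.2 + 1) (-1 : ℤ), Finsupp.single (p.1, p.2 + i) (1 : ℤ))

/-- The Demazure operator `D₀` on finitely supported functions `ℤ × ℤ → ℤ`. -/
noncomputable def demD0 (mu : (ℤ × ℤ) →₀ ℤ) : (ℤ × ℤ) →₀ ℤ :=
  mu.sum fun p c => c • elemD0 p

/-- The Demazure operator `D₁` on finitely supported functions `ℤ × ℤ → ℤ`. -/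
noncomputable def demD1 (mu : (ℤ × ℤ) →₀ ℤ) : (ℤ × ℤ) →₀ ℤ :=
  mu.sum fun p c => c • elemD1 p

/-- The weight distribution `μ_N` of the Demazure module `V_{w_N}(Λ₀)` of affine sl₂,
where a weight is written `λ = Λ₀ - a·α₀ - b·α₁`:  `μ₀ = δ_{(0,0)}`,
`μ_{N+1} = D₀ μ_N` for even `N` and `μ_{N+1} = D₁ μ_N` for odd `N`. -/
noncomputable def demMu : ℕ → (ℤ × ℤ) →₀ ℤ
  | 0 => Finsupp.single (0, 0) 1
  | (N + 1) => if Even N then demD0 (demMu N) else demD1 (demMu N)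

/-- Total mass `∑_{(a,b)} μ(a,b)` of a finitely supported signed measure, in `ℚ`. -/
noncomputable def totalMass (mu : (ℤ × ℤ) →₀ ℤ) : ℚ :=
  mu.sum fun _ c => (c : ℚ)

/-- Expected value of `f` with respect to `μ`. -/
noncomputable def expVal (mu : (ℤ × ℤ) →₀ ℤ) (f : ℤ × ℤ → ℚ) : ℚ :=
  (mu.sum fun p c => (c : ℚ) * f p) / totalMass mu

/-- Covariance of `f` and `g` with respect to `μ`. -/
noncomputable def covar (mu : (ℤ × ℤ) →₀ ℤ) (f g : ℤ × ℤ → ℚ) : ℚ :=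
  expVal mu (fun p => f p * g p) - expVal mu f * expVal mu g

/-- Variance of `f` with respect to `μ`. -/
noncomputable def var (mu : (ℤ × ℤ) →₀ ℤ) (f : ℤ × ℤ → ℚ) : ℚ :=
  covar mu f f

/-- The integral of the weight function `w` against a finitely supported signed measure. -/
noncomputable def weightedMass (w : ℤ × ℤ → ℤ) : ((ℤ × ℤ) →₀ ℤ) →ₗ[ℤ] ℤ :=
  Finsupp.linearCombination ℤ w

lemma weightedMass_single (w : ℤ × ℤ → ℤ) (p : ℤ × ℤ) (c : ℤ) :
    weightedMass w (Finsupp.single p c) = c * w p := by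
  simp [weightedMass]

lemma weightedMass_one (mu : (ℤ × ℤ) →₀ ℤ) :
    weightedMass (fun _ => 1) mu = mu.sum fun _ c => c := by
  simp [weightedMass, Finsupp.linearCombination_apply]

lemma weightedMass_demD0 (w : ℤ × ℤ → ℤ) (mu : (ℤ × ℤ) →₀ ℤ) :
    weightedMass w (demD0 mu) = weightedMass (fun p => weightedMass w (elemD0 p)) mu := by
  rw [demD0, map_finsuppSum]
  simp [weightedMass, Finsupp.linearCombination_apply]

lemma weightedMass_demD1 (w : ℤ × ℤ → ℤ) (mu : (ℤ × ℤ) →₀ ℤ) :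
    weightedMass w (demD1 mu) = weightedMass (fun p => weightedMass w (elemD1 p)) mu := by
  rw [demD1, map_finsuppSum]
  simp [weightedMass, Finsupp.linearCombination_apply]

lemma weightedMass_two_sub (w : ℤ × ℤ → ℤ) (mu : (ℤ × ℤ) →₀ ℤ) :
    weightedMass (fun p => 2 - w p) mu = 2 * weightedMass (fun _ => 1) mu - weightedMass w mu := by
  simp only [weightedMass, Finsupp.linearCombination_apply, Finsupp.sum, smul_eq_mul,
    Finset.mul_sum, ← Finset.sum_sub_distrib]
  exact Finset.sum_congr rfl fun _ _ => by ring

/-- Telescoping over an integer interval. -/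
lemma sum_Icc_int_telescope (f g : ℤ → ℤ) (hg : ∀ i, f i = g (i + 1) - g i) {a b : ℤ}
    (hab : a ≤ b + 1) : ∑ i ∈ Finset.Icc a b, f i = g (b + 1) - g a := by
  obtain ⟨k, hk⟩ := Int.le.dest hab
  obtain rfl : b = a + k - 1 := by omega
  clear hab hk
  induction k with
  | zero => simp
  | succ k ih =>
    have hins : Finset.Icc a (a + (k + 1 : ℕ) - 1) = insert (a + k) (Finset.Icc a (a + k - 1)) := by
      ext x
      simp only [Finset.mem_insert, Finset.mem_Icc]
      omega
    rw [hins, Finset.sum_insert (by simp), ih, hg]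
    push_cast
    ring_nf

/-- Telescoping for the signed sum `∑_{i=0}^{n}`, for every integer `n`. -/
lemma signed_sum_telescope (f g : ℤ → ℤ) (hg : ∀ i, f i = g (i + 1) - g i) (n : ℤ) :
    ∑ i ∈ Finset.Icc 0 n, f i - ∑ i ∈ Finset.Icc (n + 1) (-1), f i = g (n + 1) - g 0 := by
  rcases le_total (-1) n with h | h
  · rw [sum_Icc_int_telescope f g hg (by omega), Finset.Icc_eq_empty (by omega)]
    simp
  · rw [Finset.Icc_eq_empty (by omega), sum_Icc_int_telescope f g hg (by omega)]
    simp

lemma weightedMass_elemD0 (w : ℤ × ℤ → ℤ) (p : ℤ × ℤ) (g : ℤ → ℤ)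
    (hg : ∀ i, w (p.1 + i, p.2) = g (i + 1) - g i) :
    weightedMass w (elemD0 p) = g (2 - 2 * p.1 + 2 * p.2) - g 0 := by
  simp only [elemD0, map_sub, map_sum, weightedMass_single, one_mul]
  rw [signed_sum_telescope _ g hg]
  ring_nf

lemma weightedMass_elemD1 (w : ℤ × ℤ → ℤ) (p : ℤ × ℤ) (g : ℤ → ℤ)
    (hg : ∀ i, w (p.1, p.2 + i) = g (i + 1) - g i) :
    weightedMass w (elemD1 p) = g (2 * p.1 - 2 * p.2 + 1) - g 0 := by
  simp only [elemD1, map_sub, map_sum, weightedMass_single, one_mul]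
  rw [signed_sum_telescope _ g hg]

/-- Each `D₀ δ_p` is symmetric under the reflection `s₀`. -/
lemma weightedMass_demD0_eq_zero (mu : (ℤ × ℤ) →₀ ℤ) :
    weightedMass (fun p => 1 - 2 * (p.1 - p.2)) (demD0 mu) = 0 := by
  have h (p : ℤ × ℤ) : weightedMass (fun p => 1 - 2 * (p.1 - p.2)) (elemD0 p) = 0 := by
    rw [weightedMass_elemD0 _ p (fun i => i * (2 - 2 * p.1 + 2 * p.2 - i)) (fun i => by ring)]
    ring
  rw [weightedMass_demD0]
  simp only [h]
  simp [weightedMass, Finsupp.linearCombination_apply]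

/-- Each `D₁ δ_p` is symmetric under the reflection `s₁`. -/
lemma weightedMass_demD1_eq_zero (mu : (ℤ × ℤ) →₀ ℤ) :
    weightedMass (fun p => 2 * (p.1 - p.2)) (demD1 mu) = 0 := by
  have h (p : ℤ × ℤ) : weightedMass (fun p => 2 * (p.1 - p.2)) (elemD1 p) = 0 := by
    rw [weightedMass_elemD1 _ p (fun i => i * (2 * p.1 - 2 * p.2 + 1 - i)) (fun i => by ring)]
    ring
  rw [weightedMass_demD1]
  simp only [h]
  simp [weightedMass, Finsupp.linearCombination_apply]

lemma weightedMass_one_demD0 (mu : (ℤ × ℤ) →₀ ℤ) :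
    weightedMass (fun _ => 1) (demD0 mu) =
      2 * weightedMass (fun _ => 1) mu - weightedMass (fun p => 2 * (p.1 - p.2)) mu := by
  rw [weightedMass_demD0, ← weightedMass_two_sub]
  congr 2 with p
  rw [weightedMass_elemD0 _ p id (fun i => by simp)]
  simp only [id]
  ring

lemma weightedMass_one_demD1 (mu : (ℤ × ℤ) →₀ ℤ) :
    weightedMass (fun _ => 1) (demD1 mu) =
      2 * weightedMass (fun _ => 1) mu - weightedMass (fun p => 1 - 2 * (p.1 - p.2)) mu := by
  rw [weightedMass_demD1, ← weightedMass_two_sub]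
  congr 2 with p
  rw [weightedMass_elemD1 _ p id (fun i => by simp)]
  simp only [id]
  ring

lemma weightedMass_demMu_of_even {N : ℕ} (hN : Even N) :
    weightedMass (fun p => 2 * (p.1 - p.2)) (demMu N) = 0 := by
  cases N with
  | zero => simp [demMu, weightedMass_single]
  | succ N =>
    rw [demMu, if_neg (Nat.even_add_one.mp hN)]
    exact weightedMass_demD1_eq_zero _

lemma weightedMass_demMu_of_not_even {N : ℕ} (hN : ¬ Even N) :
    weightedMass (fun p => 1 - 2 * (p.1 - p.2)) (demMu N) = 0 := by
  cases N with
  | zero => simp at hN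
  | succ N =>
    rw [demMu, if_pos (by simpa [Nat.even_add_one] using hN)]
    exact weightedMass_demD0_eq_zero _

/-- The total mass of `μ_N` is `2^N`, i.e. `dim V_{w_N}(Λ₀) = 2^N`. -/
theorem demazure_total_mass (N : ℕ) :
    ((demMu N).sum fun _ c => c) = 2 ^ N := by
  rw [← weightedMass_one]
  induction N with
  | zero => simp [demMu, weightedMass_single]
  | succ N ih =>
    rw [demMu, pow_succ']
    split_ifs with hN
    · rw [weightedMass_one_demD0, weightedMass_demMu_of_even hN, ih, sub_zero]
    · rw [weightedMass_one_demD1, weightedMass_demMu_of_not_even hN, ih, sub_zero]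
end

section
/- (Sanderson's formula for the real character.) For every N ≥ 0 and every integer k, the total mass of the string {a − b = k} under μ_N is a binomial coefficient: Σ_{b∈ℤ} μ_N(b+k, b) = C(N, k + ⌊N/2⌋), where C(N,m) denotes the ordinary binomial coefficient, understood to be 0 when m < 0 or m > N. In particular, the distribution of a−b with respect to μ_N is, after a shift by ⌊N/2⌋, the unnormalized binomial distribution 2^N·B(N, 1/2). -/
/-- The pushforward of `μ` under `(a, b) ↦ a - b`. -/
noncomputable def stringMass : ((ℤ × ℤ) →₀ ℤ) →ₗ[ℤ] (ℤ →₀ ℤ) :=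
  Finsupp.lmapDomain ℤ ℤ fun p => p.1 - p.2

theorem stringMass_apply (mu : (ℤ × ℤ) →₀ ℤ) (k : ℤ) :
    stringMass mu k = mu.sum fun p c => if p.1 - p.2 = k then c else 0 := by
  simp [stringMass, Finsupp.mapDomain, Finsupp.sum_apply, Finsupp.single_apply]

theorem stringMass_single (p : ℤ × ℤ) (c : ℤ) :
    stringMass (Finsupp.single p c) = Finsupp.single (p.1 - p.2) c := by
  simp [stringMass]

theorem stringMass_elemD0_apply (p : ℤ × ℤ) (k : ℤ) :
    stringMass (elemD0 p) k =
      (if p.1 - p.2 ≤ k ∧ k ≤ 1 - (p.1 - p.2) then 1 else 0)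
      - (if 2 - (p.1 - p.2) ≤ k ∧ k ≤ p.1 - p.2 - 1 then 1 else 0) := by
  have h (i : ℤ) : p.1 + i - p.2 = k ↔ i = k - (p.1 - p.2) := by lia
  simp only [elemD0, map_sub, map_sum, stringMass_single, Finsupp.sub_apply,
    Finsupp.finsetSum_apply, Finsupp.single_apply, h, Finset.sum_ite_eq', Finset.mem_Icc]
  congr 2 <;> apply propext <;> lia

theorem stringMass_elemD1_apply (p : ℤ × ℤ) (k : ℤ) :
    stringMass (elemD1 p) k =
      (if -(p.1 - p.2) ≤ k ∧ k ≤ p.1 - p.2 then 1 else 0)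
      - (if p.1 - p.2 + 1 ≤ k ∧ k ≤ -(p.1 - p.2) - 1 then 1 else 0) := by
  have h (i : ℤ) : p.1 - (p.2 + i) = k ↔ i = p.1 - p.2 - k := by lia
  simp only [elemD1, map_sub, map_sum, stringMass_single, Finsupp.sub_apply,
    Finsupp.finsetSum_apply, Finsupp.single_apply, h, Finset.sum_ite_eq', Finset.mem_Icc]
  congr 2 <;> apply propext <;> lia

theorem sum_mul_comp_sub_eq (mu : (ℤ × ℤ) →₀ ℤ) (g : ℤ → ℤ) :
    (mu.sum fun p c => c * g (p.1 - p.2)) = (stringMass mu).sum fun j c => c * g j := by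
  simp only [stringMass, Finsupp.lmapDomain_apply]
  rw [Finsupp.sum_mapDomain_index (by simp) (by intros; ring)]

theorem stringMass_demD0_apply (mu : (ℤ × ℤ) →₀ ℤ) (k : ℤ) :
    stringMass (demD0 mu) k = (stringMass mu).sum fun j c => c *
      ((if j ≤ k ∧ k ≤ 1 - j then 1 else 0) - (if 2 - j ≤ k ∧ k ≤ j - 1 then 1 else 0)) := by
  rw [← sum_mul_comp_sub_eq]
  simp only [demD0, map_finsuppSum, map_smul, Finsupp.sum_apply, Finsupp.smul_apply, smul_eq_mul,
    stringMass_elemD0_apply]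

theorem stringMass_demD1_apply (mu : (ℤ × ℤ) →₀ ℤ) (k : ℤ) :
    stringMass (demD1 mu) k = (stringMass mu).sum fun j c => c *
      ((if -j ≤ k ∧ k ≤ j then 1 else 0) - (if j + 1 ≤ k ∧ k ≤ -j - 1 then 1 else 0)) := by
  rw [← sum_mul_comp_sub_eq]
  simp only [demD1, map_finsuppSum, map_smul, Finsupp.sum_apply, Finsupp.smul_apply, smul_eq_mul,
    stringMass_elemD1_apply]

theorem sum_mul_eq_of_reflection_symmetric (nu : ℤ →₀ ℤ) (s : ℤ) (hs : ∀ j, nu (s - j) = nu j)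
    (g : ℤ → ℤ) (k l : ℤ)
    (hg : ∀ j, g j + g (s - j) = (if j = k then 1 else 0) + (if j = s - k then 1 else 0)
      + (if j = l then 1 else 0) + (if j = s - l then 1 else 0)) :
    (nu.sum fun j c => c * g j) = nu k + nu l := by
  have h_inv : nu.mapDomain (Equiv.subLeft s) = nu := by
    ext j
    rw [Finsupp.mapDomain_equiv_apply]
    simpa [neg_add_eq_sub] using hs j
  have h_refl : (nu.sum fun j c => c * g j) = nu.sum fun j c => c * g (s - j) := by
    conv_lhs => rw [← h_inv]
    rw [Finsupp.sum_mapDomain_index (by simp) (by intros; ring)]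
    simp
  have h_eval (m : ℤ) : (nu.sum fun j c => c * if j = m then 1 else 0) = nu m := by
    simp [Finsupp.sum, eq_comm]
  have h_double : (nu.sum fun j c => c * g j) + (nu.sum fun j c => c * g (s - j)) =
      nu k + nu (s - k) + nu l + nu (s - l) := by
    rw [← h_eval k, ← h_eval (s - k), ← h_eval l, ← h_eval (s - l)]
    simp only [← Finsupp.sum_add, ← mul_add, hg]
  rw [hs, hs, ← h_refl] at h_double
  lia

theorem stringMass_demD0_apply_of_symmetric (mu : (ℤ × ℤ) →₀ ℤ)
    (hs : ∀ j, stringMass mu (0 - j) = stringMass mu j) (k : ℤ) :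
    stringMass (demD0 mu) k = stringMass mu k + stringMass mu (k - 1) := by
  rw [stringMass_demD0_apply]
  refine sum_mul_eq_of_reflection_symmetric _ 0 hs (fun j =>
    (if j ≤ k ∧ k ≤ 1 - j then 1 else 0) - (if 2 - j ≤ k ∧ k ≤ j - 1 then 1 else 0)) k (k - 1) ?_
  intro j
  grind

theorem stringMass_demD1_apply_of_symmetric (mu : (ℤ × ℤ) →₀ ℤ)
    (hs : ∀ j, stringMass mu (1 - j) = stringMass mu j) (k : ℤ) :
    stringMass (demD1 mu) k = stringMass mu k + stringMass mu (k + 1) := by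
  rw [stringMass_demD1_apply]
  refine sum_mul_eq_of_reflection_symmetric _ 1 hs (fun j =>
    (if -j ≤ k ∧ k ≤ j then 1 else 0) - (if j + 1 ≤ k ∧ k ≤ -j - 1 then 1 else 0)) k (k + 1) ?_
  intro j
  grind

/-- The binomial coefficient `C(N, m)` for an integer `m`, zero if `m < 0` or `m > N`. -/
def intChoose (N : ℕ) (m : ℤ) : ℤ :=
  if 0 ≤ m then (N.choose m.toNat : ℤ) else 0

theorem intChoose_symm (N : ℕ) (m : ℤ) : intChoose N (N - m) = intChoose N m := by
  unfold intChoose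
  rcases lt_or_ge m 0 with hm | hm
  · rw [if_pos (by lia), if_neg (by lia), Nat.choose_eq_zero_of_lt (by lia), Nat.cast_zero]
  · lift m to ℕ using hm
    by_cases h : m ≤ N
    · rw [if_pos (by lia), if_pos (by lia), Int.toNat_natCast, ← Nat.choose_symm h]
      congr 2
      lia
    · rw [if_neg (by lia), if_pos (by lia), Nat.choose_eq_zero_of_lt (by lia), Nat.cast_zero]

theorem intChoose_succ (N : ℕ) (m : ℤ) :
    intChoose (N + 1) m = intChoose N m + intChoose N (m - 1) := by
  unfold intChoose
  rcases lt_trichotomy m 0 with hm | rfl | hm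
  · rw [if_neg (by lia), if_neg (by lia), if_neg (by lia), add_zero]
  · simp
  · obtain ⟨n, rfl⟩ : ∃ n : ℕ, m = n + 1 := ⟨(m - 1).toNat, by lia⟩
    rw [if_pos (by lia), if_pos (by lia), if_pos (by lia), add_sub_cancel_right,
      Int.toNat_natCast_add_one, Int.toNat_natCast, Nat.choose_succ_succ]
    push_cast
    ring

theorem stringMass_demMu_apply (N : ℕ) (k : ℤ) :
    stringMass (demMu N) k = intChoose N (k + ((N / 2 : ℕ) : ℤ)) := by
  induction N generalizing k with
  | zero =>
    rw [demMu, stringMass_single, Finsupp.single_apply]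
    unfold intChoose
    rcases lt_trichotomy k 0 with hk | rfl | hk
    · rw [if_neg (by simp; lia), if_neg (by simp; lia)]
    · simp
    · rw [if_neg (by simp; lia), if_pos (by simp; lia), Nat.choose_eq_zero_of_lt (by simp; lia),
        Nat.cast_zero]
  | succ N ih =>
    rw [demMu, intChoose_succ]
    split_ifs with hN
    · rw [stringMass_demD0_apply_of_symmetric, ih, ih]
      · congr 2 <;> grind
      · intro j
        rw [ih, ih, ← intChoose_symm]
        congr 1
        grind
    · rw [stringMass_demD1_apply_of_symmetric, ih, ih, add_comm]
      · congr 2 <;> grind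
      · intro j
        rw [ih, ih, ← intChoose_symm]
        congr 1
        grind

/-- Sanderson's formula for the real character: the mass of the string `{a - b = k}`
under `μ_N` is the binomial coefficient `C(N, k + ⌊N/2⌋)` (zero out of range). -/
theorem sanderson_real_character (N : ℕ) (k : ℤ) :
    ((demMu N).sum fun p c => if p.1 - p.2 = k then c else 0) =
      (if 0 ≤ k + ((N / 2 : ℕ) : ℤ) then (N.choose (k + ((N / 2 : ℕ) : ℤ)).toNat : ℤ)
       else 0) := by
  rw [← stringMass_apply]
  exact stringMass_demMu_apply N k
end

section
/- (Demazure multiplicities as coefficients of Gaussian binomial coefficients.) Let N ≥ 0 be even. Then for all integers a, b, the value μ_N(a,b) equals the coefficient of q^{N²/4 − a} in the Gaussian binomial coefficient [N choose a−b+N/2]_q, where the coefficient of q^m is understood to be 0 for m < 0. -/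
/-- The Gaussian binomial coefficient `[N choose k]_q ∈ ℤ[q]`, defined by the q-Pascal
recursion `[N choose k] = [N-1 choose k-1] + q^k [N-1 choose k]`, with `[0 choose 0] = 1`
and `[N choose k] = 0` whenever `k < 0` or `k > N`. -/
noncomputable def gaussBinom : ℕ → ℤ → Polynomial ℤ
  | 0, k => if k = 0 then 1 else 0
  | (N + 1), k =>
      if 0 ≤ k ∧ k ≤ (N : ℤ) + 1 then
        gaussBinom N (k - 1) + Polynomial.X ^ k.toNat * gaussBinom N k
      else 0

/-- The coefficient of `q^e` in `[n choose k]_q` for an arbitrary integer exponent `e`, equal to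
`0` for negative `e`. -/
noncomputable def gaussCoeff (n : ℕ) (k e : ℤ) : ℤ :=
  if 0 ≤ e then (gaussBinom n k).coeff e.toNat else 0

theorem gaussBinom_eq_zero (n : ℕ) (k : ℤ) (h : k < 0 ∨ (n : ℤ) < k) : gaussBinom n k = 0 := by
  cases n with
  | zero =>
    rw [gaussBinom, if_neg]
    rintro rfl
    simp at h
  | succ n =>
    rw [gaussBinom, if_neg]
    push_cast at h
    omega

theorem gaussCoeff_eq_zero (n : ℕ) (k e : ℤ) (h : k < 0 ∨ (n : ℤ) < k) :
    gaussCoeff n k e = 0 := by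
  simp [gaussCoeff, gaussBinom_eq_zero n k h]

theorem gaussCoeff_zero (k e : ℤ) : gaussCoeff 0 k e = if k = 0 ∧ e = 0 then 1 else 0 := by
  unfold gaussCoeff gaussBinom
  by_cases hk : k = 0
  · simp only [hk, if_true, true_and, Polynomial.coeff_one]
    split_ifs <;> first | rfl | omega
  · simp [hk]

/-- The defining `q`-Pascal recursion, valid for all integers `k` and `e`. -/
theorem gaussCoeff_succ (n : ℕ) (k e : ℤ) :
    gaussCoeff (n + 1) k e = gaussCoeff n (k - 1) e + gaussCoeff n k (e - k) := by
  by_cases hk : 0 ≤ k ∧ k ≤ (n : ℤ) + 1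
  · unfold gaussCoeff
    rw [gaussBinom, if_pos hk]
    simp only [Polynomial.coeff_add, Polynomial.coeff_X_pow_mul']
    have h : (e - k).toNat = e.toNat - k.toNat := by omega
    rw [h]
    split_ifs <;> omega
  · rw [gaussCoeff_eq_zero (n + 1) k e (by push_cast; omega),
      gaussCoeff_eq_zero n (k - 1) e (by omega), gaussCoeff_eq_zero n k _ (by omega), add_zero]

/-- The second `q`-Pascal recursion `[n+1 choose k] = [n choose k] + q^(n+1-k) [n choose k-1]`. -/
theorem gaussCoeff_succ' (n : ℕ) (k e : ℤ) :
    gaussCoeff (n + 1) k e = gaussCoeff n k e + gaussCoeff n (k - 1) (e - (n + 1 - k)) := by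
  induction n generalizing k e with
  | zero =>
    rw [gaussCoeff_succ]
    simp only [gaussCoeff_zero]
    split_ifs <;> omega
  | succ n ih =>
    rw [gaussCoeff_succ (n + 1), ih (k - 1), ih k, gaussCoeff_succ n k,
      gaussCoeff_succ n (k - 1)]
    push_cast
    ring_nf

theorem gaussCoeff_symm (n : ℕ) (k e : ℤ) : gaussCoeff n (n - k) e = gaussCoeff n k e := by
  induction n generalizing k e with
  | zero =>
    simp only [gaussCoeff_zero]
    split_ifs <;> omega
  | succ n ih =>
    rw [gaussCoeff_succ n k, gaussCoeff_succ' n, ← ih (k - 1), ← ih k]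
    push_cast
    ring_nf

theorem sum_single_fst_apply (s : Finset ℤ) (x y a b : ℤ) :
    (∑ i ∈ s, Finsupp.single (x + i, y) (1 : ℤ)) (a, b) =
      if y = b ∧ a - x ∈ s then 1 else 0 := by
  have h (i : ℤ) : (Finsupp.single (x + i, y) (1 : ℤ)) (a, b) =
      if a - x = i then (if y = b then 1 else 0) else 0 := by
    simp only [Finsupp.single_apply, Prod.mk.injEq]
    split_ifs <;> omega
  simp only [Finsupp.finsetSum_apply, h, Finset.sum_ite_eq]
  split_ifs <;> simp_all

theorem sum_single_snd_apply (s : Finset ℤ) (x y a b : ℤ) :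
    (∑ i ∈ s, Finsupp.single (x, y + i) (1 : ℤ)) (a, b) =
      if x = a ∧ b - y ∈ s then 1 else 0 := by
  have h (i : ℤ) : (Finsupp.single (x, y + i) (1 : ℤ)) (a, b) =
      if b - y = i then (if x = a then 1 else 0) else 0 := by
    simp only [Finsupp.single_apply, Prod.mk.injEq]
    split_ifs <;> omega
  simp only [Finsupp.finsetSum_apply, h, Finset.sum_ite_eq]
  split_ifs <;> simp_all

theorem elemD0_apply_sub (p : ℤ × ℤ) (a b : ℤ) :
    elemD0 p (a, b) - elemD0 p (a - 1, b) =
      Finsupp.single p (1 : ℤ) (a, b) - Finsupp.single p (1 : ℤ) (2 * b + 2 - a, b) := by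
  obtain ⟨x, y⟩ := p
  simp only [elemD0, Finsupp.sub_apply, sum_single_fst_apply, Finsupp.single_apply,
    Prod.mk.injEq, Finset.mem_Icc]
  split_ifs <;> omega

theorem elemD1_apply_sub (p : ℤ × ℤ) (a b : ℤ) :
    elemD1 p (a, b) - elemD1 p (a, b - 1) =
      Finsupp.single p (1 : ℤ) (a, b) - Finsupp.single p (1 : ℤ) (a, 2 * a + 1 - b) := by
  obtain ⟨x, y⟩ := p
  simp only [elemD1, Finsupp.sub_apply, sum_single_snd_apply, Finsupp.single_apply,
    Prod.mk.injEq, Finset.mem_Icc]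
  split_ifs <;> omega

/-- Reconstruction of a finitely supported function from its values on single points. -/
theorem apply_eq_sum_single (mu : (ℤ × ℤ) →₀ ℤ) (x : ℤ × ℤ) :
    mu x = mu.sum fun p c => c * Finsupp.single p (1 : ℤ) x := by
  conv_lhs => rw [← mu.sum_single]
  simp [Finsupp.sum, Finsupp.finsetSum_apply, Finsupp.single_apply]

theorem demD0_apply_sub (mu : (ℤ × ℤ) →₀ ℤ) (a b : ℤ) :
    demD0 mu (a, b) - demD0 mu (a - 1, b) = mu (a, b) - mu (2 * b + 2 - a, b) := by
  rw [apply_eq_sum_single mu (a, b), apply_eq_sum_single mu (2 * b + 2 - a, b)]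
  simp only [demD0, Finsupp.sum, Finsupp.finsetSum_apply, Finsupp.smul_apply, smul_eq_mul,
    ← Finset.sum_sub_distrib, ← mul_sub, elemD0_apply_sub]

theorem demD1_apply_sub (mu : (ℤ × ℤ) →₀ ℤ) (a b : ℤ) :
    demD1 mu (a, b) - demD1 mu (a, b - 1) = mu (a, b) - mu (a, 2 * a + 1 - b) := by
  rw [apply_eq_sum_single mu (a, b), apply_eq_sum_single mu (a, 2 * a + 1 - b)]
  simp only [demD1, Finsupp.sum, Finsupp.finsetSum_apply, Finsupp.smul_apply, smul_eq_mul,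
    ← Finset.sum_sub_distrib, ← mul_sub, elemD1_apply_sub]

/-- Two integer sequences with equal differences that agree somewhere agree everywhere. -/
theorem eq_of_sub_eq_sub {f g : ℤ → ℤ} (h : ∀ x, f x - f (x - 1) = g x - g (x - 1))
    {x₀ : ℤ} (h₀ : f x₀ = g x₀) (x : ℤ) : f x = g x := by
  induction x using Int.inductionOn' (b := x₀) with
  | zero => exact h₀
  | succ k _ ih =>
    have := h (k + 1)
    rw [add_sub_cancel_right] at this
    linarith
  | pred k _ ih => linarith [h k]

theorem exists_lt_apply_fst_eq_zero (nu : (ℤ × ℤ) →₀ ℤ) (b A : ℤ) :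
    ∃ x < A, nu (x, b) = 0 := by
  obtain ⟨M, hM⟩ := (nu.support.image Prod.fst).bddBelow
  refine ⟨min M A - 1, by linarith [min_le_right M A], ?_⟩
  by_contra hne
  have := hM (Finset.mem_image_of_mem Prod.fst (Finsupp.mem_support_iff.mpr hne))
  linarith [min_le_left M A]

theorem exists_lt_apply_snd_eq_zero (nu : (ℤ × ℤ) →₀ ℤ) (a B : ℤ) :
    ∃ y < B, nu (a, y) = 0 := by
  obtain ⟨M, hM⟩ := (nu.support.image Prod.snd).bddBelow
  refine ⟨min M B - 1, by linarith [min_le_right M B], ?_⟩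
  by_contra hne
  have := hM (Finset.mem_image_of_mem Prod.snd (Finsupp.mem_support_iff.mpr hne))
  linarith [min_le_left M B]

theorem demD0_apply_eq_gaussCoeff (m : ℕ) (mu : (ℤ × ℤ) →₀ ℤ)
    (h : ∀ a b : ℤ, mu (a, b) = gaussCoeff (2 * m) (a - b + m) ((m : ℤ) ^ 2 - a)) (a b : ℤ) :
    demD0 mu (a, b) = gaussCoeff (2 * m + 1) (a - b + m) ((m : ℤ) ^ 2 + m - b) := by
  obtain ⟨x₀, hx₀, hz⟩ := exists_lt_apply_fst_eq_zero (demD0 mu) b (b - m)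
  refine eq_of_sub_eq_sub (f := fun a => demD0 mu (a, b))
    (g := fun a => gaussCoeff (2 * m + 1) (a - b + m) ((m : ℤ) ^ 2 + m - b)) (fun x => ?_)
    (x₀ := x₀) ?_ a
  · rw [demD0_apply_sub, h, h, gaussCoeff_succ _ (x - b + m), gaussCoeff_succ' _ (x - 1 - b + m),
      ← gaussCoeff_symm (2 * m) (2 * b + 2 - x - b + m)]
    push_cast
    ring_nf
  · simp only [hz]
    rw [gaussCoeff_eq_zero _ _ _ (by omega)]

theorem demD1_apply_eq_gaussCoeff (m : ℕ) (mu : (ℤ × ℤ) →₀ ℤ)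
    (h : ∀ a b : ℤ, mu (a, b) = gaussCoeff (2 * m + 1) (a - b + m) ((m : ℤ) ^ 2 + m - b))
    (a b : ℤ) :
    demD1 mu (a, b) = gaussCoeff (2 * m + 2) (a - b + (m + 1)) (((m : ℤ) + 1) ^ 2 - a) := by
  obtain ⟨y₀, hy₀, hz⟩ := exists_lt_apply_snd_eq_zero (demD1 mu) a (a - m - 1)
  refine eq_of_sub_eq_sub (f := fun b => demD1 mu (a, b))
    (g := fun b => gaussCoeff (2 * m + 2) (a - b + (m + 1)) (((m : ℤ) + 1) ^ 2 - a))
    (fun y => ?_) (x₀ := y₀) ?_ b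
  · rw [demD1_apply_sub, h, h, gaussCoeff_succ' (2 * m + 1) (a - y + (m + 1)),
      gaussCoeff_succ (2 * m + 1) (a - (y - 1) + (m + 1)),
      ← gaussCoeff_symm (2 * m + 1) (a - (2 * a + 1 - y) + m)]
    push_cast
    ring_nf
  · simp only [hz]
    rw [gaussCoeff_eq_zero _ _ _ (by push_cast; omega)]

theorem demMu_two_mul_apply (m : ℕ) (a b : ℤ) :
    demMu (2 * m) (a, b) = gaussCoeff (2 * m) (a - b + m) ((m : ℤ) ^ 2 - a) := by
  induction m generalizing a b with
  | zero =>
    simp only [mul_zero, demMu, gaussCoeff_zero, Finsupp.single_apply, Prod.mk.injEq]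
    norm_num
    split_ifs <;> omega
  | succ m ih =>
    have hmu : demMu (2 * (m + 1)) = demD1 (demD0 (demMu (2 * m))) := by
      rw [show 2 * (m + 1) = 2 * m + 1 + 1 by ring, demMu, if_neg (by simp), demMu,
        if_pos (by simp)]
    rw [hmu, demD1_apply_eq_gaussCoeff m _ (demD0_apply_eq_gaussCoeff m _ ih)]
    push_cast
    rfl

/-- For even `N`, the Demazure multiplicity `μ_N(a,b)` is the coefficient of
`q^(N²/4 - a)` in the Gaussian binomial coefficient `[N choose a-b+N/2]_q`
(understood to be `0` for negative exponents). -/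
theorem demazure_mult_eq_gauss_coeff (N : ℕ) (hN : Even N) (a b : ℤ) :
    (demMu N) (a, b) =
      (if 0 ≤ (N : ℤ) ^ 2 / 4 - a then
        (gaussBinom N (a - b + (N : ℤ) / 2)).coeff ((N : ℤ) ^ 2 / 4 - a).toNat
       else 0) := by
  obtain ⟨m, rfl⟩ := even_iff_exists_two_mul.mp hN
  have hdiv : ((2 * m : ℕ) : ℤ) / 2 = m := by omega
  have hsq : ((2 * m : ℕ) : ℤ) ^ 2 / 4 = (m : ℤ) ^ 2 := by
    push_cast
    rw [mul_pow]
    omega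
  rw [demMu_two_mul_apply, hdiv, hsq, gaussCoeff]
end

section
/- For every odd N ≥ 1, the measure μ_N is invariant under the reflection (a,b) ↦ (2b+1−a, b), i.e. μ_N(a,b) = μ_N(2b+1−a, b) for all integers a, b. Consequently, Cov_{μ_N}(b, a−b) = 0 and Cov_{μ_N}(b², a−b) = 0. -/
theorem elemD0_apply_reflection (p : ℤ × ℤ) (a b : ℤ) :
    elemD0 p (a, b) = elemD0 p (2 * b + 1 - a, b) := by
  obtain ⟨c, d⟩ := p
  have key (s t x : ℤ) :
      (∑ i ∈ Finset.Icc s t, Finsupp.single (c + i, d) (1 : ℤ)) (x, b) =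
        if d = b ∧ s ≤ x - c ∧ x - c ≤ t then 1 else 0 := by
    have single_apply (i : ℤ) : (Finsupp.single (c + i, d) (1 : ℤ)) (x, b) =
        if i = x - c then (if d = b then 1 else 0) else 0 := by
      rw [Finsupp.single_apply, ← ite_and]
      refine if_congr ?_ rfl rfl
      rw [Prod.mk.injEq]
      omega
    rw [Finsupp.finsetSum_apply, Finset.sum_congr rfl fun i _ => single_apply i,
      Finset.sum_ite_eq', ← ite_and]
    exact if_congr (by rw [Finset.mem_Icc, and_comm]) rfl rfl
  simp only [elemD0, Finsupp.sub_apply, key]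
  split_ifs <;> omega

theorem demD0_apply_reflection (mu : (ℤ × ℤ) →₀ ℤ) (a b : ℤ) :
    demD0 mu (a, b) = demD0 mu (2 * b + 1 - a, b) := by
  simp only [demD0, Finsupp.sum_apply, Finsupp.smul_apply, elemD0_apply_reflection _ a b]

theorem sum_mul_fst_sub_snd_of_reflection {mu : (ℤ × ℤ) →₀ ℤ}
    (h : ∀ a b : ℤ, mu (a, b) = mu (2 * b + 1 - a, b)) (g : ℤ → ℚ) :
    (mu.sum fun p c => (c : ℚ) * (g p.2 * ((p.1 : ℚ) - (p.2 : ℚ)))) =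
      1 / 2 * mu.sum fun p c => (c : ℚ) * g p.2 := by
  rw [← sub_eq_zero, Finsupp.sum, Finsupp.sum, Finset.mul_sum, ← Finset.sum_sub_distrib]
  have anti (p : ℤ × ℤ) :
      (mu p : ℚ) * (g p.2 * ((p.1 : ℚ) - (p.2 : ℚ))) - 1 / 2 * ((mu p : ℚ) * g p.2) +
        ((mu (2 * p.2 + 1 - p.1, p.2) : ℚ) *
            (g p.2 * (((2 * p.2 + 1 - p.1 : ℤ) : ℚ) - (p.2 : ℚ))) -
          1 / 2 * ((mu (2 * p.2 + 1 - p.1, p.2) : ℚ) * g p.2)) = 0 := by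
    rw [← h p.1 p.2]
    push_cast
    ring
  refine Finset.sum_involution (fun p _ => (2 * p.2 + 1 - p.1, p.2)) (fun p _ => anti p)
    (fun p _ _ hp => ?_) (fun p hp => ?_) (fun p _ => ?_)
  · have := congrArg Prod.fst hp
    dsimp only at this
    omega
  · rw [Finsupp.mem_support_iff] at hp ⊢
    rwa [← h p.1 p.2]
  · ext <;> simp

theorem covar_snd_fst_sub_snd_of_reflection {mu : (ℤ × ℤ) →₀ ℤ}
    (h : ∀ a b : ℤ, mu (a, b) = mu (2 * b + 1 - a, b)) (g : ℤ → ℚ) :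
    covar mu (fun p => g p.2) (fun p => (p.1 : ℚ) - (p.2 : ℚ)) = 0 := by
  have mean := sum_mul_fst_sub_snd_of_reflection h fun _ => 1
  simp only [one_mul, mul_one] at mean
  rw [covar, expVal, expVal, expVal, sum_mul_fst_sub_snd_of_reflection h g, mean]
  change _ - _ * (1 / 2 * totalMass mu / totalMass mu) = 0
  by_cases hm : totalMass mu = 0
  · simp [hm]
  · field_simp
    ring

/-- For odd `N`, `μ_N` is invariant under the reflection `(a,b) ↦ (2b+1-a, b)`;
consequently `Cov(b, a-b) = 0` and `Cov(b², a-b) = 0`. -/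
theorem odd_reflection_symmetry (N : ℕ) (hN : Odd N) :
    (∀ a b : ℤ, (demMu N) (a, b) = (demMu N) (2 * b + 1 - a, b)) ∧
    covar (demMu N) (fun p => (p.2 : ℚ)) (fun p => (p.1 : ℚ) - (p.2 : ℚ)) = 0 ∧
    covar (demMu N) (fun p => (p.2 : ℚ) ^ 2) (fun p => (p.1 : ℚ) - (p.2 : ℚ)) = 0 := by
  have symm (a b : ℤ) : (demMu N) (a, b) = (demMu N) (2 * b + 1 - a, b) := by
    obtain ⟨k, rfl⟩ := hN
    rw [show demMu (2 * k + 1) = _ from if_pos (even_two_mul k)]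
    exact demD0_apply_reflection _ a b
  exact ⟨symm, covar_snd_fst_sub_snd_of_reflection symm fun b => (b : ℚ),
    covar_snd_fst_sub_snd_of_reflection symm fun b => (b : ℚ) ^ 2⟩
end

section
/- (Almost a recursion formula.) For every odd N ≥ 1: E_{μ_{N+1}}[a²] = E_{μ_N}[a²] + N(N²+N+2)/16 + 2·Cov_{μ_N}(b, (a−b)²). For every even N ≥ 0: E_{μ_{N+1}}[b²] = E_{μ_N}[b²] + N²(N+1)/16 + 2·Cov_{μ_N}(a, (a−b)²). -/
/-- Integration of a rational function against a finitely supported signed measure, as a linear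
functional of the function. -/
noncomputable def pairing (mu : (ℤ × ℤ) →₀ ℤ) : (ℤ × ℤ → ℚ) →ₗ[ℚ] ℚ where
  toFun f := mu.sum fun p c => (c : ℚ) * f p
  map_add' f g := by simp [Finsupp.sum, mul_add, Finset.sum_add_distrib]
  map_smul' r f := by simp [Finsupp.sum, Finset.mul_sum, mul_left_comm]

/-- Integration against a finitely supported signed measure, as an additive map of the measure. -/
noncomputable def pairingHom (f : ℤ × ℤ → ℚ) : ((ℤ × ℤ) →₀ ℤ) →+ ℚ :=
  Finsupp.liftAddHom fun p => (AddMonoidHom.mulRight (f p)).comp (Int.castAddHom ℚ)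

lemma pairingHom_apply (f : ℤ × ℤ → ℚ) (mu : (ℤ × ℤ) →₀ ℤ) :
    pairingHom f mu = pairing mu f := rfl

lemma pairing_single (p : ℤ × ℤ) (c : ℤ) (f : ℤ × ℤ → ℚ) :
    pairing (Finsupp.single p c) f = c * f p := by
  simp [pairing]

lemma totalMass_eq_pairing (mu : (ℤ × ℤ) →₀ ℤ) : totalMass mu = pairing mu (fun _ => 1) := by
  simp [totalMass, pairing]

lemma expVal_eq_pairing (mu : (ℤ × ℤ) →₀ ℤ) (f : ℤ × ℤ → ℚ) :
    expVal mu f = pairing mu f / totalMass mu := rfl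

lemma pairing_sum_smul (mu : (ℤ × ℤ) →₀ ℤ) (e : ℤ × ℤ → (ℤ × ℤ) →₀ ℤ) (f : ℤ × ℤ → ℚ) :
    pairing (mu.sum fun p c => c • e p) f = pairing mu (fun p => pairing (e p) f) := by
  rw [← pairingHom_apply, map_finsuppSum]
  simp only [map_zsmul, pairingHom_apply, zsmul_eq_mul]
  rfl

/-- The sum `∑_{i=0}^n F i` with the convention for negative `n` used in the Demazure operators. -/
noncomputable def signedSum (F : ℤ → ℚ) (n : ℤ) : ℚ :=
  ∑ i ∈ Finset.Icc 0 n, F i - ∑ i ∈ Finset.Icc (n + 1) (-1), F i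

lemma pairing_elemD0 (p : ℤ × ℤ) (f : ℤ × ℤ → ℚ) :
    pairing (elemD0 p) f = signedSum (fun i => f (p.1 + i, p.2)) (1 - 2 * p.1 + 2 * p.2) := by
  rw [← pairingHom_apply, elemD0, map_sub, map_sum, map_sum]
  simp only [pairingHom_apply, pairing_single, Int.cast_one, one_mul, signedSum]

lemma pairing_elemD1 (p : ℤ × ℤ) (f : ℤ × ℤ → ℚ) :
    pairing (elemD1 p) f = signedSum (fun i => f (p.1, p.2 + i)) (2 * p.1 - 2 * p.2) := by
  rw [← pairingHom_apply, elemD1, map_sub, map_sum, map_sum]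
  simp only [pairingHom_apply, pairing_single, Int.cast_one, one_mul, signedSum]

lemma signedSum_of_telescope {F G : ℤ → ℚ} (h : ∀ i, G (i + 1) - G i = F i) (n : ℤ) :
    signedSum F n = G (n + 1) - G 0 := by
  obtain ⟨k, hk⟩ := (n + 1).eq_nat_or_neg
  rcases hk with hk | hk
  · obtain rfl : n = (k : ℤ) - 1 := by lia
    have hpos : ∀ m : ℕ, ∑ i ∈ Finset.Icc (0 : ℤ) ((m : ℤ) - 1), F i = G m - G 0 := by
      intro m
      induction m with
      | zero => simp
      | succ m ih =>
        have : Finset.Icc (0 : ℤ) (((m + 1 : ℕ) : ℤ) - 1)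
            = insert (m : ℤ) (Finset.Icc (0 : ℤ) ((m : ℤ) - 1)) := by
          ext i; simp only [Finset.mem_Icc, Finset.mem_insert]; lia
        rw [this, Finset.sum_insert (by simp), ih, ← h]
        push_cast; ring
    have hemp : Finset.Icc ((k : ℤ) - 1 + 1) (-1) = ∅ := Finset.Icc_eq_empty (by lia)
    rw [signedSum, hpos, hemp]
    simp
  · obtain rfl : n = -(k : ℤ) - 1 := by lia
    have hneg : ∀ m : ℕ, ∑ i ∈ Finset.Icc (-(m : ℤ)) (-1), F i = G 0 - G (-m) := by
      intro m
      induction m with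
      | zero => simp
      | succ m ih =>
        have : Finset.Icc (-((m + 1 : ℕ) : ℤ)) (-1)
            = insert (-(m : ℤ) - 1) (Finset.Icc (-(m : ℤ)) (-1)) := by
          ext i; simp only [Finset.mem_Icc, Finset.mem_insert]; lia
        rw [this, Finset.sum_insert (by simp), ih, ← h,
          show -((m + 1 : ℕ) : ℤ) = -(m : ℤ) - 1 by push_cast; ring,
          show -(m : ℤ) - 1 + 1 = -m by ring]
        ring
    have hemp : Finset.Icc (0 : ℤ) (-(k : ℤ) - 1) = ∅ := Finset.Icc_eq_empty (by lia)
    rw [signedSum, hemp, show -(k : ℤ) - 1 + 1 = -k by ring, hneg]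
    simp

lemma signedSum_const (c : ℚ) (n : ℤ) : signedSum (fun _ => c) n = c * (n + 1) := by
  rw [signedSum_of_telescope (G := fun i => c * i) (by intro i; push_cast; ring)]
  push_cast; ring

lemma signedSum_eq_zero {F : ℤ → ℚ} {n : ℤ} (h : ∀ i, F (n - i) = -F i) :
    signedSum F n = 0 := by
  have hrefl : ∀ l u : ℤ, l + u = n → ∑ i ∈ Finset.Icc l u, F i = 0 := by
    intro l u hlu
    have : ∑ i ∈ Finset.Icc l u, F i = ∑ i ∈ Finset.Icc l u, -F i :=
      Finset.sum_nbij' (n - ·) (n - ·) (by intro i; simp only [Finset.mem_Icc]; lia)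
        (by intro i; simp only [Finset.mem_Icc]; lia) (by simp) (by simp)
        (by intro i _; rw [h, neg_neg])
    rw [Finset.sum_neg_distrib] at this
    linarith
  rw [signedSum, hrefl _ _ (by ring), hrefl _ _ (by ring), sub_zero]

lemma pairing_demD0_eq_zero (mu : (ℤ × ℤ) →₀ ℤ) {f : ℤ × ℤ → ℚ}
    (hf : ∀ a b, f (1 + 2 * b - a, b) = -f (a, b)) : pairing (demD0 mu) f = 0 := by
  have (p : ℤ × ℤ) : pairing (elemD0 p) f = 0 := by
    rw [pairing_elemD0]
    refine signedSum_eq_zero fun i => ?_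
    rw [← hf]
    congr 2; ring
  rw [demD0, pairing_sum_smul, funext this]
  exact map_zero _

lemma pairing_demD1_eq_zero (mu : (ℤ × ℤ) →₀ ℤ) {f : ℤ × ℤ → ℚ}
    (hf : ∀ a b, f (a, 2 * a - b) = -f (a, b)) : pairing (demD1 mu) f = 0 := by
  have (p : ℤ × ℤ) : pairing (elemD1 p) f = 0 := by
    rw [pairing_elemD1]
    refine signedSum_eq_zero fun i => ?_
    rw [← hf]
    congr 2; ring
  rw [demD1, pairing_sum_smul, funext this]
  exact map_zero _

/-- Integrals of functions of `b` alone against `D₀ μ`. -/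
lemma pairing_demD0_snd (mu : (ℤ × ℤ) →₀ ℤ) (g : ℤ → ℚ) :
    pairing (demD0 mu) (fun p => g p.2)
      = pairing mu (fun p => g p.2 * (2 - 2 * ((p.1 : ℚ) - p.2))) := by
  rw [demD0, pairing_sum_smul]
  congr 1; ext p
  rw [pairing_elemD0, signedSum_const (g p.2)]
  push_cast; ring

/-- Integrals of functions of `a` alone against `D₁ μ`. -/
lemma pairing_demD1_fst (mu : (ℤ × ℤ) →₀ ℤ) (g : ℤ → ℚ) :
    pairing (demD1 mu) (fun p => g p.1)
      = pairing mu (fun p => g p.1 * (2 * ((p.1 : ℚ) - p.2) + 1)) := by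
  rw [demD1, pairing_sum_smul]
  congr 1; ext p
  rw [pairing_elemD1, signedSum_const (g p.1)]
  push_cast; ring

lemma pairing_demD0_sq (mu : (ℤ × ℤ) →₀ ℤ) :
    pairing (demD0 mu) (fun p => ((p.1 : ℚ) - p.2 - 1 / 2) ^ 2)
      = pairing mu (fun p => -(2 / 3) * ((p.1 : ℚ) - p.2 - 1 / 2) * ((p.1 : ℚ) - p.2 - 3 / 2)
          * ((p.1 : ℚ) - p.2 - 1)) := by
  rw [demD0, pairing_sum_smul]
  congr 1; ext p
  rw [pairing_elemD0, signedSum_of_telescope (G := fun i =>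
    ((p.1 : ℚ) + i - p.2 - 1 / 2) * ((p.1 : ℚ) + i - p.2 - 3 / 2)
      * (2 * ((p.1 : ℚ) + i - p.2) - 2) / 6) (by intro i; push_cast; ring)]
  push_cast; ring

lemma pairing_demD1_sq (mu : (ℤ × ℤ) →₀ ℤ) :
    pairing (demD1 mu) (fun p => ((p.1 : ℚ) - p.2) ^ 2)
      = pairing mu (fun p => ((p.1 : ℚ) - p.2) * ((p.1 : ℚ) - p.2 + 1)
          * (2 * ((p.1 : ℚ) - p.2) + 1) / 3) := by
  rw [demD1, pairing_sum_smul]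
  congr 1; ext p
  rw [pairing_elemD1, signedSum_of_telescope (G := fun i =>
    ((p.2 : ℚ) + i - p.1) * ((p.2 : ℚ) + i - p.1 - 1)
      * (2 * ((p.2 : ℚ) + i - p.1) - 1) / 6) (by intro i; push_cast; ring)]
  push_cast; ring

/-- Symmetry and low moments of `μ_N` for even `N`. -/
structure EvenMoments (N : ℕ) (mu : (ℤ × ℤ) →₀ ℤ) : Prop where
  anti : ∀ f : ℤ × ℤ → ℚ, (∀ a b, f (a, 2 * a - b) = -f (a, b)) → pairing mu f = 0
  mass : pairing mu (fun _ => 1) = 2 ^ N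
  sq : pairing mu (fun p => ((p.1 : ℚ) - p.2) ^ 2) = N / 4 * 2 ^ N
  fst : pairing mu (fun p => (p.1 : ℚ)) = N * (N + 1) / 8 * 2 ^ N

/-- Symmetry and low moments of `μ_N` for odd `N`. -/
structure OddMoments (N : ℕ) (mu : (ℤ × ℤ) →₀ ℤ) : Prop where
  anti : ∀ f : ℤ × ℤ → ℚ, (∀ a b, f (1 + 2 * b - a, b) = -f (a, b)) → pairing mu f = 0
  mass : pairing mu (fun _ => 1) = 2 ^ N
  sq : pairing mu (fun p => ((p.1 : ℚ) - p.2 - 1 / 2) ^ 2) = N / 4 * 2 ^ N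
  snd : pairing mu (fun p => (p.2 : ℚ)) = (N ^ 2 + N - 2) / 8 * 2 ^ N

lemma EvenMoments.demD0 {N : ℕ} {mu : (ℤ × ℤ) →₀ ℤ} (h : EvenMoments N mu) :
    OddMoments (N + 1) (demD0 mu) where
  anti _ hf := pairing_demD0_eq_zero mu hf
  mass := by
    rw [pairing_demD0_snd mu (fun _ => 1),
      show (fun p : ℤ × ℤ => 1 * (2 - 2 * ((p.1 : ℚ) - p.2)))
        = (2 : ℚ) • (fun _ => 1) + fun p => -2 * ((p.1 : ℚ) - p.2) by
          ext p; simp; ring,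
      map_add, map_smul, h.mass, h.anti _ (by intro a b; push_cast; ring), smul_eq_mul]
    ring
  sq := by
    rw [pairing_demD0_sq,
      show (fun p : ℤ × ℤ => -(2 / 3) * ((p.1 : ℚ) - p.2 - 1 / 2) * ((p.1 : ℚ) - p.2 - 3 / 2)
          * ((p.1 : ℚ) - p.2 - 1))
        = (2 : ℚ) • (fun p : ℤ × ℤ => ((p.1 : ℚ) - p.2) ^ 2) + (1 / 2 : ℚ) • (fun _ => 1)
          + fun p => -(2 / 3) * ((p.1 : ℚ) - p.2) ^ 3 - 11 / 6 * ((p.1 : ℚ) - p.2) by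
          ext p; simp; ring,
      map_add, map_add, map_smul, map_smul, h.mass, h.sq,
      h.anti _ (by intro a b; push_cast; ring), smul_eq_mul, smul_eq_mul]
    push_cast; ring
  snd := by
    rw [pairing_demD0_snd mu (fun b => b),
      show (fun p : ℤ × ℤ => (p.2 : ℚ) * (2 - 2 * ((p.1 : ℚ) - p.2)))
        = (2 : ℚ) • (fun p : ℤ × ℤ => (p.1 : ℚ))
          + (2 : ℚ) • (fun p : ℤ × ℤ => ((p.1 : ℚ) - p.2) ^ 2)
          + fun p => -2 * ((p.1 : ℚ) + 1) * ((p.1 : ℚ) - p.2) by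
          ext p; simp; ring,
      map_add, map_add, map_smul, map_smul, h.fst, h.sq,
      h.anti _ (by intro a b; push_cast; ring), smul_eq_mul, smul_eq_mul]
    push_cast; ring

lemma OddMoments.demD1 {N : ℕ} {mu : (ℤ × ℤ) →₀ ℤ} (h : OddMoments N mu) :
    EvenMoments (N + 1) (demD1 mu) where
  anti _ hf := pairing_demD1_eq_zero mu hf
  mass := by
    rw [pairing_demD1_fst mu (fun _ => 1),
      show (fun p : ℤ × ℤ => 1 * (2 * ((p.1 : ℚ) - p.2) + 1))
        = (2 : ℚ) • (fun _ => 1) + fun p => 2 * ((p.1 : ℚ) - p.2 - 1 / 2) by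
          ext p; simp; ring,
      map_add, map_smul, h.mass, h.anti _ (by intro a b; push_cast; ring), smul_eq_mul]
    ring
  sq := by
    rw [pairing_demD1_sq,
      show (fun p : ℤ × ℤ => ((p.1 : ℚ) - p.2) * ((p.1 : ℚ) - p.2 + 1)
          * (2 * ((p.1 : ℚ) - p.2) + 1) / 3)
        = (2 : ℚ) • (fun p : ℤ × ℤ => ((p.1 : ℚ) - p.2 - 1 / 2) ^ 2) + (1 / 2 : ℚ) • (fun _ => 1)
          + fun p => 2 / 3 * ((p.1 : ℚ) - p.2 - 1 / 2) ^ 3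
            + 11 / 6 * ((p.1 : ℚ) - p.2 - 1 / 2) by
          ext p; simp; ring,
      map_add, map_add, map_smul, map_smul, h.mass, h.sq,
      h.anti _ (by intro a b; push_cast; ring), smul_eq_mul, smul_eq_mul]
    push_cast; ring
  fst := by
    rw [pairing_demD1_fst mu (fun a => a),
      show (fun p : ℤ × ℤ => (p.1 : ℚ) * (2 * ((p.1 : ℚ) - p.2) + 1))
        = (2 : ℚ) • (fun p : ℤ × ℤ => (p.2 : ℚ)) + (fun _ => 1)
          + (2 : ℚ) • (fun p : ℤ × ℤ => ((p.1 : ℚ) - p.2 - 1 / 2) ^ 2)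
          + fun p => (2 * (p.2 : ℚ) + 3) * ((p.1 : ℚ) - p.2 - 1 / 2) by
          ext p; simp; ring,
      map_add, map_add, map_add, map_smul, map_smul, h.mass, h.snd, h.sq,
      h.anti _ (by intro a b; push_cast; ring), smul_eq_mul, smul_eq_mul]
    push_cast; ring

lemma moments_demMu (N : ℕ) :
    (Even N → EvenMoments N (demMu N)) ∧ (Odd N → OddMoments N (demMu N)) := by
  induction N with
  | zero =>
    refine ⟨fun _ => ⟨fun f hf => ?_, ?_, ?_, ?_⟩, fun h => absurd h (by simp)⟩
    · have h0 := hf 0 0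
      simp only [mul_zero, sub_zero] at h0
      rw [demMu, pairing_single, Int.cast_one]
      linarith
    all_goals simp [demMu, pairing_single]
  | succ N ih =>
    refine ⟨fun h => ?_, fun h => ?_⟩
    · have hN : ¬ Even N := by grind
      rw [demMu, if_neg hN]
      exact (ih.2 (by simpa using hN)).demD1
    · have hN : Even N := by grind
      rw [demMu, if_pos hN]
      exact (ih.1 hN).demD0

lemma OddMoments.expVal_demD1_fst_sq {N : ℕ} {mu : (ℤ × ℤ) →₀ ℤ} (h : OddMoments N mu) :
    expVal (_root_.demD1 mu) (fun p => (p.1 : ℚ) ^ 2)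
      = expVal mu (fun p => (p.1 : ℚ) ^ 2) + (N : ℚ) * ((N : ℚ) ^ 2 + N + 2) / 16
        + 2 * covar mu (fun p => (p.2 : ℚ)) (fun p => ((p.1 : ℚ) - p.2) ^ 2) := by
  have hcube : pairing (_root_.demD1 mu) (fun p => (p.1 : ℚ) ^ 2)
      = 2 * pairing mu (fun p => (p.1 : ℚ) ^ 2)
        + 4 * pairing mu (fun p => (p.2 : ℚ) * ((p.1 : ℚ) - p.2 - 1 / 2) ^ 2)
        + 2 * pairing mu (fun p => ((p.1 : ℚ) - p.2 - 1 / 2) ^ 2) := by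
    rw [pairing_demD1_fst mu (fun a => (a : ℚ) ^ 2),
      show (fun p : ℤ × ℤ => (p.1 : ℚ) ^ 2 * (2 * ((p.1 : ℚ) - p.2) + 1))
        = (2 : ℚ) • (fun p : ℤ × ℤ => (p.1 : ℚ) ^ 2)
          + (4 : ℚ) • (fun p : ℤ × ℤ => (p.2 : ℚ) * ((p.1 : ℚ) - p.2 - 1 / 2) ^ 2)
          + (2 : ℚ) • (fun p : ℤ × ℤ => ((p.1 : ℚ) - p.2 - 1 / 2) ^ 2)
          + fun p => 2 * ((p.1 : ℚ) - p.2 - 1 / 2) ^ 3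
            + 2 * ((p.2 : ℚ) + 1 / 2) ^ 2 * ((p.1 : ℚ) - p.2 - 1 / 2) by
          ext p; simp; ring,
      map_add, map_add, map_add, map_smul, map_smul, map_smul,
      h.anti (fun p => 2 * ((p.1 : ℚ) - p.2 - 1 / 2) ^ 3
        + 2 * ((p.2 : ℚ) + 1 / 2) ^ 2 * ((p.1 : ℚ) - p.2 - 1 / 2))
        (by intro a b; push_cast; ring)]
    simp
  have hsq : pairing mu (fun p => ((p.1 : ℚ) - p.2) ^ 2) = (N / 4 + 1 / 4) * 2 ^ N := by
    rw [show (fun p : ℤ × ℤ => ((p.1 : ℚ) - p.2) ^ 2)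
        = (fun p : ℤ × ℤ => ((p.1 : ℚ) - p.2 - 1 / 2) ^ 2) + (1 / 4 : ℚ) • (fun _ => 1)
          + fun p => (p.1 : ℚ) - p.2 - 1 / 2 by
          ext p; simp; ring,
      map_add, map_add, map_smul, h.sq, h.mass, h.anti _ (by intro a b; push_cast; ring),
      smul_eq_mul]
    ring
  have hmix : pairing mu (fun p => (p.2 : ℚ) * ((p.1 : ℚ) - p.2) ^ 2)
      = pairing mu (fun p => (p.2 : ℚ) * ((p.1 : ℚ) - p.2 - 1 / 2) ^ 2)
        + 1 / 4 * ((N ^ 2 + N - 2) / 8 * 2 ^ N) := by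
    rw [← h.snd, show (fun p : ℤ × ℤ => (p.2 : ℚ) * ((p.1 : ℚ) - p.2) ^ 2)
        = (fun p : ℤ × ℤ => (p.2 : ℚ) * ((p.1 : ℚ) - p.2 - 1 / 2) ^ 2)
          + (1 / 4 : ℚ) • (fun p : ℤ × ℤ => (p.2 : ℚ))
          + fun p => (p.2 : ℚ) * ((p.1 : ℚ) - p.2 - 1 / 2) by
          ext p; simp; ring,
      map_add, map_add, map_smul, h.anti (fun p => (p.2 : ℚ) * ((p.1 : ℚ) - p.2 - 1 / 2))
        (by intro a b; push_cast; ring), smul_eq_mul]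
    ring
  simp only [covar, expVal_eq_pairing, totalMass_eq_pairing]
  rw [hcube, h.demD1.mass, h.mass, hmix, hsq, h.snd, h.sq, pow_succ]
  field_simp
  ring

lemma EvenMoments.expVal_demD0_snd_sq {N : ℕ} {mu : (ℤ × ℤ) →₀ ℤ} (h : EvenMoments N mu) :
    expVal (_root_.demD0 mu) (fun p => (p.2 : ℚ) ^ 2)
      = expVal mu (fun p => (p.2 : ℚ) ^ 2) + (N : ℚ) ^ 2 * ((N : ℚ) + 1) / 16
        + 2 * covar mu (fun p => (p.1 : ℚ)) (fun p => ((p.1 : ℚ) - p.2) ^ 2) := by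
  have hcube : pairing (_root_.demD0 mu) (fun p => (p.2 : ℚ) ^ 2)
      = 2 * pairing mu (fun p => (p.2 : ℚ) ^ 2)
        + 4 * pairing mu (fun p => (p.1 : ℚ) * ((p.1 : ℚ) - p.2) ^ 2) := by
    rw [pairing_demD0_snd mu (fun b => (b : ℚ) ^ 2),
      show (fun p : ℤ × ℤ => (p.2 : ℚ) ^ 2 * (2 - 2 * ((p.1 : ℚ) - p.2)))
        = (2 : ℚ) • (fun p : ℤ × ℤ => (p.2 : ℚ) ^ 2)
          + (4 : ℚ) • (fun p : ℤ × ℤ => (p.1 : ℚ) * ((p.1 : ℚ) - p.2) ^ 2)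
          + fun p => -2 * ((p.1 : ℚ) - p.2) ^ 3 - 2 * (p.1 : ℚ) ^ 2 * ((p.1 : ℚ) - p.2) by
          ext p; simp; ring,
      map_add, map_add, map_smul, map_smul,
      h.anti (fun p => -2 * ((p.1 : ℚ) - p.2) ^ 3 - 2 * (p.1 : ℚ) ^ 2 * ((p.1 : ℚ) - p.2))
        (by intro a b; push_cast; ring)]
    simp
  simp only [covar, expVal_eq_pairing, totalMass_eq_pairing]
  rw [hcube, h.demD0.mass, h.mass, h.sq, h.fst, pow_succ]
  field_simp
  ring

/-- Almost a recursion formula: for odd `N`,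
`E_{μ_{N+1}}[a²] = E_{μ_N}[a²] + N(N²+N+2)/16 + 2 Cov_{μ_N}(b, (a-b)²)`, and for even `N`,
`E_{μ_{N+1}}[b²] = E_{μ_N}[b²] + N²(N+1)/16 + 2 Cov_{μ_N}(a, (a-b)²)`. -/
theorem almost_recursion (N : ℕ) :
    (Odd N →
      expVal (demMu (N + 1)) (fun p => (p.1 : ℚ) ^ 2) =
        expVal (demMu N) (fun p => (p.1 : ℚ) ^ 2)
        + (N : ℚ) * ((N : ℚ) ^ 2 + (N : ℚ) + 2) / 16
        + 2 * covar (demMu N) (fun p => (p.2 : ℚ))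
            (fun p => ((p.1 : ℚ) - (p.2 : ℚ)) ^ 2)) ∧
    (Even N →
      expVal (demMu (N + 1)) (fun p => (p.2 : ℚ) ^ 2) =
        expVal (demMu N) (fun p => (p.2 : ℚ) ^ 2)
        + (N : ℚ) ^ 2 * ((N : ℚ) + 1) / 16
        + 2 * covar (demMu N) (fun p => (p.1 : ℚ))
            (fun p => ((p.1 : ℚ) - (p.2 : ℚ)) ^ 2)) := by
  refine ⟨fun h => ?_, fun h => ?_⟩
  · rw [demMu, if_neg (Nat.not_even_iff_odd.mpr h)]
    exact ((moments_demMu N).2 h).expVal_demD1_fst_sq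
  · rw [demMu, if_pos h]
    exact ((moments_demMu N).1 h).expVal_demD0_snd_sq
end

section
/- For every odd N ≥ 1, Cov_{μ_N}((a−b)² − (a−b) − 2b, (a−b)² − (a−b)) = 0. -/
theorem sum_Ico_int_sub (G : ℤ → ℚ) (a : ℤ) (k : ℕ) :
    ∑ i ∈ Finset.Ico a (a + k), (G (i + 1) - G i) = G (a + k) - G a := by
  induction k with
  | zero => simp
  | succ k ih =>
    have h : Finset.Ico a (a + (k + 1 : ℕ)) = insert (a + (k : ℤ)) (Finset.Ico a (a + k)) := by
      ext i
      simp only [Finset.mem_insert, Finset.mem_Ico]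
      omega
    rw [h, Finset.sum_insert (by simp), ih]
    push_cast
    rw [← add_assoc]
    ring

theorem signed_sum_Icc_sub (G : ℤ → ℚ) (n : ℤ) :
    ∑ i ∈ Finset.Icc 0 n, (G (i + 1) - G i) - ∑ i ∈ Finset.Icc (n + 1) (-1), (G (i + 1) - G i)
      = G (n + 1) - G 0 := by
  rcases le_total 0 (n + 1) with h | h
  · obtain ⟨k, hk⟩ := Int.eq_ofNat_of_zero_le h
    have h₁ : Finset.Icc 0 n = Finset.Ico 0 (0 + (k : ℤ)) := by
      ext i
      simp only [Finset.mem_Icc, Finset.mem_Ico]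
      omega
    have h₂ : Finset.Icc (n + 1) (-1) = ∅ := Finset.Icc_eq_empty (by omega)
    rw [h₁, h₂, sum_Ico_int_sub, hk]
    simp
  · obtain ⟨k, hk⟩ := Int.eq_ofNat_of_zero_le (neg_nonneg.mpr h)
    have h₁ : Finset.Icc 0 n = ∅ := Finset.Icc_eq_empty (by omega)
    have h₂ : Finset.Icc (n + 1) (-1) = Finset.Ico (n + 1) (n + 1 + (k : ℤ)) := by
      ext i
      simp only [Finset.mem_Icc, Finset.mem_Ico]
      omega
    rw [h₁, h₂, sum_Ico_int_sub, show n + 1 + (k : ℤ) = 0 by omega]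
    simp

/-- The pairing `∑ μ(a,b) f(a,b)`. -/
noncomputable def demPairing (mu : (ℤ × ℤ) →₀ ℤ) (f : ℤ × ℤ → ℚ) : ℚ :=
  Finsupp.linearCombination ℤ f mu

theorem sum_mul_eq_demPairing (mu : (ℤ × ℤ) →₀ ℤ) (f : ℤ × ℤ → ℚ) :
    (mu.sum fun p c => (c : ℚ) * f p) = demPairing mu f := by
  simp [demPairing, Finsupp.linearCombination_apply]

/-- If `f` is the forward difference of `G` along the `α₀`-strings, then pairing `D₀ μ` with `f`
telescopes. -/
theorem demPairing_demD0 (mu : (ℤ × ℤ) →₀ ℤ) (f G : ℤ × ℤ → ℚ)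
    (hG : ∀ a b, G (a + 1, b) - G (a, b) = f (a, b)) :
    demPairing (demD0 mu) f
      = demPairing mu fun p => G (2 - p.1 + 2 * p.2, p.2) - G p := by
  have h : demD0 mu = Finsupp.linearCombination ℤ elemD0 mu := rfl
  rw [demPairing, h, Finsupp.apply_linearCombination, demPairing]
  congr 2
  funext p
  have hs := signed_sum_Icc_sub (fun i => G (p.1 + i, p.2)) (1 - 2 * p.1 + 2 * p.2)
  simp only [← add_assoc, hG] at hs
  simp only [Function.comp, elemD0, map_sub, map_sum, Finsupp.linearCombination_single, one_smul]
  rw [hs]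
  congr 3 <;> ring_nf

/-- If `f` is the forward difference of `G` along the `α₁`-strings, then pairing `D₁ μ` with `f`
telescopes. -/
theorem demPairing_demD1 (mu : (ℤ × ℤ) →₀ ℤ) (f G : ℤ × ℤ → ℚ)
    (hG : ∀ a b, G (a, b + 1) - G (a, b) = f (a, b)) :
    demPairing (demD1 mu) f
      = demPairing mu fun p => G (p.1, 2 * p.1 - p.2 + 1) - G p := by
  have h : demD1 mu = Finsupp.linearCombination ℤ elemD1 mu := rfl
  rw [demPairing, h, Finsupp.apply_linearCombination, demPairing]
  congr 2
  funext p
  have hs := signed_sum_Icc_sub (fun i => G (p.1, p.2 + i)) (2 * p.1 - 2 * p.2)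
  simp only [← add_assoc, hG] at hs
  simp only [Function.comp, elemD1, map_sub, map_sum, Finsupp.linearCombination_single, one_smul]
  rw [hs]
  congr 3 <;> ring_nf

/-- The general polynomial in `z` and `q` of weighted degree at most five (`z` has weight one,
`q` weight two) that is of degree at most one in `q`. -/
def weightFivePoly (c : Fin 6 → ℚ) (d : Fin 4 → ℚ) (z q : ℚ) : ℚ :=
  c 0 + c 1 * z + c 2 * z ^ 2 + c 3 * z ^ 3 + c 4 * z ^ 4 + c 5 * z ^ 5
    + (d 0 + d 1 * z + d 2 * z ^ 2 + d 3 * z ^ 3) * q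

/-- The moments of `μ_N` in a coordinate `z` centred on the last root strings and in the Weyl
group invariant `q = (a-b)² - a`, up to weighted degree five. -/
def HasDemMoments (mu : (ℤ × ℤ) →₀ ℤ) (z : ℤ × ℤ → ℚ) (N : ℕ) : Prop :=
  ∀ (c : Fin 6 → ℚ) (d : Fin 4 → ℚ),
    demPairing mu (fun p => weightFivePoly c d (z p) (((p.1 : ℚ) - p.2) ^ 2 - p.1))
      = 2 ^ N * (c 0 + c 2 * (N / 4) + c 4 * (3 * N ^ 2 / 16 - N / 8)
        + d 0 * ((N - N ^ 2) / 8) + d 2 * ((-2 * N + 3 * N ^ 2 - N ^ 3) / 32))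

/-- An antidifference in `w` of `weightFivePoly c d w (w ^ 2 - e)`. -/
def weightFiveAntidiff (c : Fin 6 → ℚ) (d : Fin 4 → ℚ) (e w : ℚ) : ℚ :=
  (c 0 - e * d 0) * w + (c 1 - e * d 1) * (w * (w - 1) / 2)
    + (c 2 + d 0 - e * d 2) * ((w - 1) * w * (2 * w - 1) / 6)
    + (c 3 + d 1 - e * d 3) * ((w * (w - 1) / 2) ^ 2)
    + (c 4 + d 2) * ((w - 1) * w * (2 * w - 1) * (3 * (w - 1) ^ 2 + 3 * (w - 1) - 1) / 30)
    + (c 5 + d 3) * ((w - 1) ^ 2 * w ^ 2 * (2 * (w - 1) ^ 2 + 2 * (w - 1) - 1) / 12)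

theorem weightFiveAntidiff_sub (c : Fin 6 → ℚ) (d : Fin 4 → ℚ) (e w : ℚ) :
    weightFiveAntidiff c d e (w + 1) - weightFiveAntidiff c d e w
      = weightFivePoly c d w (w ^ 2 - e) := by
  simp only [weightFiveAntidiff, weightFivePoly]
  ring

/-- Both Demazure operators act on the moments in the same way. -/
theorem HasDemMoments.step {mu nu : (ℤ × ℤ) →₀ ℤ} {z w : ℤ × ℤ → ℚ} {N : ℕ}
    (h : HasDemMoments mu z N)
    (hstring : ∀ (c : Fin 6 → ℚ) (d : Fin 4 → ℚ),
      demPairing nu (fun p => weightFivePoly c d (w p) (((p.1 : ℚ) - p.2) ^ 2 - p.1))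
        = demPairing mu fun p =>
          weightFiveAntidiff c d ((z p + 1 / 2) ^ 2 - (((p.1 : ℚ) - p.2) ^ 2 - p.1)) (z p + 3 / 2)
          - weightFiveAntidiff c d ((z p + 1 / 2) ^ 2 - (((p.1 : ℚ) - p.2) ^ 2 - p.1))
            (-(z p + 1 / 2))) :
    HasDemMoments nu w (N + 1) := by
  intro c d
  have key := h
    ![2 * c 0 + c 2 / 2 + c 4 / 8,
      2 * c 0 + 11 / 6 * c 2 + 127 / 120 * c 4 - 2 / 3 * d 0 + d 2 / 10,
      2 * c 2 + 3 * c 4 - 2 * d 0 + d 2 / 6,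
      2 / 3 * c 2 + 11 / 3 * c 4 - 4 / 3 * d 0 - d 2 / 3,
      2 * c 4 - 2 / 3 * d 2,
      2 / 5 * c 4 - 4 / 15 * d 2]
    ![2 * d 0 + d 2 / 2, 2 * d 0 + 11 / 6 * d 2, 2 * d 2, 2 / 3 * d 2]
  rw [hstring]
  convert key using 1
  · congr 1
    funext p
    simp [weightFiveAntidiff, weightFivePoly]
    ring
  · simp
    ring

theorem hasDemMoments_zero : HasDemMoments (demMu 0) (fun p => -((p.1 : ℚ) - p.2)) 0 := by
  intro c d
  simp [demMu, demPairing, weightFivePoly]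

theorem HasDemMoments.demD0 {mu : (ℤ × ℤ) →₀ ℤ} {N : ℕ}
    (h : HasDemMoments mu (fun p => -((p.1 : ℚ) - p.2)) N) :
    HasDemMoments (demD0 mu) (fun p => (p.1 : ℚ) - p.2 - 1 / 2) (N + 1) := by
  refine h.step fun c d => ?_
  rw [demPairing_demD0 mu _
    (fun p => weightFiveAntidiff c d ((p.2 : ℚ) + 1 / 4) ((p.1 : ℚ) - p.2 - 1 / 2))]
  · congr 1
    funext p
    push_cast
    congr 2 <;> ring_nf
  · intro a b
    have hd := weightFiveAntidiff_sub c d ((b : ℚ) + 1 / 4) ((a : ℚ) - b - 1 / 2)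
    push_cast
    convert hd using 2 <;> ring_nf

theorem HasDemMoments.demD1 {mu : (ℤ × ℤ) →₀ ℤ} {N : ℕ}
    (h : HasDemMoments mu (fun p => (p.1 : ℚ) - p.2 - 1 / 2) N) :
    HasDemMoments (demD1 mu) (fun p => -((p.1 : ℚ) - p.2)) (N + 1) := by
  refine h.step fun c d => ?_
  rw [demPairing_demD1 mu _
    (fun p => weightFiveAntidiff c d (p.1 : ℚ) (-((p.1 : ℚ) - p.2)))]
  · congr 1
    funext p
    push_cast
    congr 2 <;> ring_nf
  · intro a b
    have hd := weightFiveAntidiff_sub c d (a : ℚ) (-((a : ℚ) - b))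
    push_cast
    convert hd using 2 <;> ring_nf

theorem hasDemMoments_demMu_two_mul (k : ℕ) :
    HasDemMoments (demMu (2 * k)) (fun p => -((p.1 : ℚ) - p.2)) (2 * k) := by
  induction k with
  | zero => exact hasDemMoments_zero
  | succ k ih =>
    have h : demMu (2 * (k + 1)) = demD1 (demD0 (demMu (2 * k))) := by
      simp [mul_add, demMu]
    rw [h]
    exact ih.demD0.demD1

theorem hasDemMoments_demMu_of_odd {N : ℕ} (hN : Odd N) :
    HasDemMoments (demMu N) (fun p => (p.1 : ℚ) - p.2 - 1 / 2) N := by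
  obtain ⟨k, rfl⟩ := hN
  simp only [demMu, even_two_mul, if_true]
  exact (hasDemMoments_demMu_two_mul k).demD0

/-- For odd `N`, `Cov_{μ_N}((a-b)² - (a-b) - 2b, (a-b)² - (a-b)) = 0`. -/
theorem odd_stretched_covariance_zero (N : ℕ) (hN : Odd N) :
    covar (demMu N)
      (fun p => ((p.1 : ℚ) - (p.2 : ℚ)) ^ 2 - ((p.1 : ℚ) - (p.2 : ℚ)) - 2 * (p.2 : ℚ))
      (fun p => ((p.1 : ℚ) - (p.2 : ℚ)) ^ 2 - ((p.1 : ℚ) - (p.2 : ℚ))) = 0 := by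
  have hm := hasDemMoments_demMu_of_odd hN
  have h₁ : totalMass (demMu N) = 2 ^ N := by
    have h := hm ![1, 0, 0, 0, 0, 0] 0
    simp only [← sum_mul_eq_demPairing] at h
    simpa [totalMass, weightFivePoly] using h
  have hfg := hm ![-1 / 16, 0, 1 / 2, 0, -1, 0] ![-1 / 2, 0, 2, 0]
  have hf := hm ![1 / 4, 0, -1, 0, 0, 0] ![2, 0, 0, 0]
  have hg := hm ![-1 / 4, 0, 1, 0, 0, 0] 0
  have h₂ : (2 : ℚ) ^ N ≠ 0 := by positivity
  simp only [covar, expVal, h₁, sum_mul_eq_demPairing]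
  have key : ∀ {f f' : ℤ × ℤ → ℚ} {r : ℚ}, demPairing (demMu N) f' = r → (∀ p, f p = f' p) →
      demPairing (demMu N) f = r := fun h e => (funext e : _ = _) ▸ h
  rw [key hfg fun p => by simp [weightFivePoly]; ring,
    key hf fun p => by simp [weightFivePoly]; ring,
    key hg fun p => by simp [weightFivePoly]; ring]
  simp
  field_simp
  ring
end
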